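/- arXiv:2211.11860 — 4 statements merged into one kernel-verified Lean document; each statement's English description precedes it below -/
import Mathlib

section
/- Let b₁,…,b_d ∈ ℝ^{d−1} be random vectors with joint probability density proportional to vol_{d−1}(conv(b₁,…,b_d)) · ∏_{i=1}^d μ̄_i(b_i), where each μ̄_i is an L-log-Lipschitz density (L ≥ 1). Fix a one-dimensional line ℓ ⊂ ℝ^{d−1}, condition on ℓ ∩ conv(b₁,…,b_{d−1}) ≠ ∅, and let λ ∈ ℝ^{d−1}_{≥0} with Σ_{i} λ_i = 1 be the unique convex coefficients with Σ_{i=1}^{d−1} λ_i b_i ∈ ℓ ∩ conv(b₁,…,b_{d−1}). Let D′ be the event that ‖b_i − b_j‖₂ ≤ 3 for all i, j ∈ [d]. Then Pr[ λ_i ≥ 1/(120 d² L) for all i ∈ [d−1] | D′ ∧ (ℓ ∩ conv(b₁,…,b_{d−1}) ≠ ∅) ] ≥ 0.95. -/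
open MeasureTheory Set
open scoped ENNReal ProbabilityTheory Pointwise RealInnerProductSpace

noncomputable section

abbrev Euc (d : ℕ) := EuclideanSpace ℝ (Fin d)

/-- A probability density is `L`-log-Lipschitz. -/
def IsLogLipschitz {E : Type*} [NormedAddCommGroup E] (L : ℝ) (f : E → ℝ) : Prop :=
  (∀ x, 0 < f x) ∧ ∀ x y, f x ≤ Real.exp (L * ‖x - y‖) * f y

/-- Joint law of points `b_1,…,b_{m+1} ∈ ℝ^m` with density proportional (with constant `c`)
to `vol_m(conv(b_1,…,b_{m+1})) · ∏ i f i (b i)`. -/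
def simplexDensityMeasure {m : ℕ} (c : ℝ) (f : Fin (m + 1) → Euc m → ℝ) :
    Measure (Fin (m + 1) → Euc m) :=
  volume.withDensity fun b => ENNReal.ofReal
    (c * (volume (convexHull ℝ (Set.range b))).toReal * ∏ i, f i (b i))

variable {m : ℕ}

/-- The map `x ↦ x - ⟪v, x⟫ v`; for a unit vector `v`, the orthogonal projection along `v`. -/
def perp (v : Euc m) : Euc m →L[ℝ] Euc m :=
  ContinuousLinearMap.id ℝ _ - (innerSL ℝ v).smulRight v

lemma perp_apply (v x : Euc m) : perp v x = x - ⟪v, x⟫ • v := by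
  simp [perp]

lemma inner_perp {v : Euc m} (hv : ‖v‖ = 1) (x : Euc m) : ⟪v, perp v x⟫ = 0 := by
  simp [perp_apply, inner_sub_right, inner_smul_right, hv]

lemma perp_perp {v : Euc m} (hv : ‖v‖ = 1) (x : Euc m) : perp v (perp v x) = perp v x := by
  rw [perp_apply v (perp v x), inner_perp hv]; simp

lemma norm_perp_le {v : Euc m} (hv : ‖v‖ = 1) (x : Euc m) : ‖perp v x‖ ≤ ‖x‖ := by
  have h : ‖x‖ ^ 2 = ‖perp v x‖ ^ 2 + ‖⟪v, x⟫ • v‖ ^ 2 := by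
    have hx : x = perp v x + ⟪v, x⟫ • v := by simp [perp_apply]
    conv_lhs => rw [hx, pow_two]
    rw [norm_add_sq_eq_norm_sq_add_norm_sq_of_inner_eq_zero _ _
      (by rw [inner_smul_right, real_inner_comm v (perp v x), inner_perp hv, mul_zero])]
    ring
  exact le_of_sq_le_sq (by nlinarith [sq_nonneg ‖⟪v, x⟫ • v‖]) (norm_nonneg _)

lemma exists_perp_description (ℓ : AffineSubspace ℝ (Euc m)) (hne : (ℓ : Set (Euc m)).Nonempty)
    (hdim : Module.finrank ℝ ℓ.direction = 1) :
    ∃ v p : Euc m, ‖v‖ = 1 ∧ ∀ x, x ∈ ℓ ↔ perp v (x - p) = 0 := by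
  obtain ⟨p, hp⟩ := hne
  obtain ⟨w, hw0, hw⟩ := finrank_eq_one_iff'.1 hdim
  have hw0' : (w : Euc m) ≠ 0 := by simpa using hw0
  have hn : ‖(w : Euc m)‖ ≠ 0 := by simpa using hw0'
  refine ⟨‖(w : Euc m)‖⁻¹ • (w : Euc m), p, by simp [norm_smul, hn], fun x => ?_⟩
  have hmem : x ∈ ℓ ↔ x - p ∈ ℓ.direction := by
    constructor
    · intro hx; exact AffineSubspace.vsub_mem_direction hx hp
    · intro hx
      simpa using AffineSubspace.vadd_mem_of_mem_direction hx hp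
  rw [hmem]
  constructor
  · intro hx
    obtain ⟨c, hc⟩ := hw ⟨x - p, hx⟩
    have hc' : x - p = c • (w : Euc m) := (congrArg Subtype.val hc).symm
    rw [hc', perp_apply]
    simp only [inner_smul_left, inner_smul_right, real_inner_self_eq_norm_sq, smul_smul]
    rw [sub_eq_zero]
    congr 1
    simp
    field_simp
  · intro hx
    rw [perp_apply, sub_eq_zero] at hx
    rw [hx]
    exact ℓ.direction.smul_mem _ (ℓ.direction.smul_mem _ w.2)

/-- The weights of convex combinations of `b 0, …, b m` that do not use the last point. -/
def ridgeWeights (m : ℕ) : Set (Fin (m + 1) → ℝ) :=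
  {lam | (∀ i, 0 ≤ lam i) ∧ lam (Fin.last m) = 0 ∧ ∑ i, lam i = 1}

lemma convex_ridgeWeights : Convex ℝ (ridgeWeights m) := by
  rintro x ⟨hx0, hx1, hx2⟩ y ⟨hy0, hy1, hy2⟩ a b ha hb hab
  refine ⟨fun i => ?_, ?_, ?_⟩
  · have := hx0 i; have := hy0 i
    simp only [Pi.add_apply, Pi.smul_apply, smul_eq_mul]; positivity
  · simp [hx1, hy1]
  · simp [Finset.sum_add_distrib, ← Finset.mul_sum, hx2, hy2, hab]

lemma isCompact_ridgeWeights : IsCompact (ridgeWeights m) := by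
  have : ridgeWeights m = stdSimplex ℝ (Fin (m + 1)) ∩ {lam | lam (Fin.last m) = 0} := by
    ext lam
    simp only [ridgeWeights, stdSimplex, mem_ofPred_eq, mem_inter_iff]
    tauto
  rw [this]
  exact (isCompact_stdSimplex ℝ _).inter_right
    (isClosed_eq (continuous_apply _) continuous_const)

lemma convexHull_ridge_eq (b : Fin (m + 1) → Euc m) :
    convexHull ℝ (b '' {i | i ≠ Fin.last m}) =
      (fun lam : Fin (m + 1) → ℝ => ∑ i, lam i • b i) '' ridgeWeights m := by
  apply Subset.antisymm
  · refine convexHull_min ?_ ?_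
    · rintro _ ⟨i, hi, rfl⟩
      refine ⟨Pi.single i 1, ⟨fun j => ?_, ?_, ?_⟩, ?_⟩
      · by_cases h : j = i
        · subst h; simp
        · simp [h]
      · exact Pi.single_eq_of_ne (Ne.symm hi) _
      · simp
      · simp [Pi.single_apply]
    · exact convex_ridgeWeights.is_linear_image (f := fun lam => ∑ i, lam i • b i)
        ⟨fun x y => by simp [add_smul, Finset.sum_add_distrib],
          fun c x => by simp [Finset.smul_sum, smul_smul]⟩
  · rintro _ ⟨lam, ⟨h0, h1, h2⟩, rfl⟩
    have hs : ∀ {M : Type} [AddCommGroup M] (g : Fin (m + 1) → M), g (Fin.last m) = 0 →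
        ∑ i, g i = ∑ i ∈ Finset.univ.erase (Fin.last m), g i := fun g hg => by
      rw [Finset.sum_erase _ hg]
    dsimp only
    rw [hs _ (by simp [h1])]
    exact (convex_convexHull ℝ _).sum_mem (fun i _ => h0 i) (by rw [← hs _ h1, h2])
      fun i hi => subset_convexHull ℝ _ ⟨i, by simpa using hi, rfl⟩

/-- All points are at mutual distance at most `3`, and the line `ℓ` meets the ridge spanned by all
points but the last. -/
def ridgeEvent (ℓ : AffineSubspace ℝ (Euc m)) : Set (Fin (m + 1) → Euc m) :=
  {b | ∀ i j, dist (b i) (b j) ≤ 3} ∩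
    {b | ((ℓ : Set (Euc m)) ∩ convexHull ℝ (b '' {i | i ≠ Fin.last m})).Nonempty}

lemma mem_ridgeEvent_iff {ℓ : AffineSubspace ℝ (Euc m)} {b : Fin (m + 1) → Euc m} :
    b ∈ ridgeEvent ℓ ↔ (∀ i j, dist (b i) (b j) ≤ 3) ∧
      ∃ lam ∈ ridgeWeights m, ∑ i, lam i • b i ∈ ℓ := by
  simp only [ridgeEvent, convexHull_ridge_eq, mem_inter_iff, mem_ofPred_eq]
  refine and_congr_right fun _ => ⟨?_, ?_⟩
  · rintro ⟨_, h, lam, hlam, rfl⟩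
    exact ⟨lam, hlam, h⟩
  · rintro ⟨lam, hlam, h⟩
    exact ⟨_, h, lam, hlam, rfl⟩

lemma isClosed_ridgeEvent (ℓ : AffineSubspace ℝ (Euc m)) : IsClosed (ridgeEvent ℓ) := by
  have hℓ : IsClosed (ℓ : Set (Euc m)) := ℓ.closed_of_finiteDimensional
  have : ridgeEvent ℓ = {b | ∀ i j, dist (b i) (b j) ≤ 3} ∩
      Prod.snd '' {q : ridgeWeights m × (Fin (m + 1) → Euc m) |
        ∑ i, q.1.1 i • q.2 i ∈ (ℓ : Set (Euc m))} := by
    ext b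
    rw [mem_ridgeEvent_iff]
    simp
  rw [this]
  have : CompactSpace (ridgeWeights m) := isCompact_iff_compactSpace.1 isCompact_ridgeWeights
  refine IsClosed.inter ?_ (isClosedMap_snd_of_compactSpace _ (hℓ.preimage ?_))
  · simp only [ofPred_forall]
    exact isClosed_iInter fun i => isClosed_iInter fun j =>
      isClosed_le (by fun_prop) continuous_const
  · exact continuous_finsetSum _ fun i _ =>
      ((continuous_apply i).comp (continuous_subtype_val.comp continuous_fst)).smul
        ((continuous_apply i).comp continuous_snd)

/-- Translate all points by `-ε` times the displacement of `b i` from the line through `p` with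
direction `v`. -/
def slide (ε : ℝ) (v p : Euc m) (i : Fin (m + 1)) (b : Fin (m + 1) → Euc m) :
    Fin (m + 1) → Euc m :=
  fun j => b j - ε • perp v (b i - p)

lemma exists_weights_slide {ε : ℝ} (hε0 : 0 ≤ ε) (hε1 : ε ≤ 1) {v p : Euc m} (hv : ‖v‖ = 1)
    {i : Fin (m + 1)} (hi : i ≠ Fin.last m) {b : Fin (m + 1) → Euc m} {lam : Fin (m + 1) → ℝ}
    (hlam : lam ∈ ridgeWeights m) (hb : perp v (∑ j, lam j • b j - p) = 0) :
    ∃ lam' ∈ ridgeWeights m, perp v (∑ j, lam' j • slide ε v p i b j - p) = 0 ∧ ε ≤ lam' i := by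
  obtain ⟨h0, h1, h2⟩ := hlam
  have hsum : ∑ j, ((1 - ε) * lam j + ε * (Pi.single i 1 : Fin (m + 1) → ℝ) j) = 1 := by
    simp [Finset.sum_add_distrib, ← Finset.mul_sum, h2]
  refine ⟨fun j => (1 - ε) * lam j + ε * (Pi.single i 1 : Fin (m + 1) → ℝ) j,
    ⟨fun j => ?_, ?_, hsum⟩, ?_, ?_⟩
  · have hs : 0 ≤ (Pi.single i 1 : Fin (m + 1) → ℝ) j := by
      by_cases h : j = i
      · subst h; simp
      · simp [h]
    have := h0 j
    have : 0 ≤ 1 - ε := by linarith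
    positivity
  · simp [h1, Pi.single_eq_of_ne (Ne.symm hi)]
  · have e : ∑ j, ((1 - ε) * lam j + ε * (Pi.single i 1 : Fin (m + 1) → ℝ) j) •
        slide ε v p i b j =
        (1 - ε) • ∑ j, lam j • b j + ε • b i - ε • perp v (b i - p) := by
      simp only [slide, smul_sub, Finset.sum_sub_distrib, ← Finset.sum_smul, hsum, one_smul]
      simp [add_smul, Finset.sum_add_distrib, Finset.smul_sum, smul_smul, Pi.single_apply]
    have e' : (1 - ε) • ∑ j, lam j • b j + ε • b i - ε • perp v (b i - p) - p =
        (1 - ε) • (∑ j, lam j • b j - p) + ε • ((b i - p) - perp v (b i - p)) := by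
      module
    simp only [e, e', map_add, map_smul, hb, map_sub _ (b i - p), perp_perp hv]
    simp
  · have := h0 i
    have : 0 ≤ (1 - ε) * lam i := mul_nonneg (by linarith) this
    simp only [Pi.single_eq_same]
    linarith

lemma slide_mem_ridgeEvent {ε : ℝ} (hε0 : 0 ≤ ε) (hε1 : ε ≤ 1) {v p : Euc m} (hv : ‖v‖ = 1)
    {ℓ : AffineSubspace ℝ (Euc m)} (hℓ : ∀ x, x ∈ ℓ ↔ perp v (x - p) = 0)
    {i : Fin (m + 1)} (hi : i ≠ Fin.last m) {b : Fin (m + 1) → Euc m} (hb : b ∈ ridgeEvent ℓ) :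
    slide ε v p i b ∈ ridgeEvent ℓ := by
  rw [mem_ridgeEvent_iff] at hb ⊢
  obtain ⟨hd, lam, hlam, h⟩ := hb
  obtain ⟨lam', hlam', h', -⟩ := exists_weights_slide hε0 hε1 hv hi hlam ((hℓ _).1 h)
  exact ⟨fun j k => by simpa [slide] using hd j k, lam', hlam', (hℓ _).2 h'⟩

lemma norm_perp_sub_le_of_mem_ridgeEvent {v p : Euc m} (hv : ‖v‖ = 1)
    {ℓ : AffineSubspace ℝ (Euc m)} (hℓ : ∀ x, x ∈ ℓ ↔ perp v (x - p) = 0)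
    (i : Fin (m + 1)) {b : Fin (m + 1) → Euc m} (hb : b ∈ ridgeEvent ℓ) :
    ‖perp v (b i - p)‖ ≤ 3 := by
  obtain ⟨hd, z, hzℓ, hz⟩ := hb
  have hz3 : z ∈ Metric.closedBall (b i) 3 := by
    refine convexHull_min ?_ (convex_closedBall _ _) hz
    rintro _ ⟨j, -, rfl⟩
    exact hd j i
  have e : perp v (b i - p) = perp v (b i - z) := by
    rw [← sub_add_sub_cancel (b i) z p, map_add, (hℓ z).1 hzℓ, add_zero]
  rw [e]
  exact (norm_perp_le hv _).trans (by rwa [mem_closedBall_iff_norm'] at hz3)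

lemma volume_convexHull_slide (ε : ℝ) (v p : Euc m) (i : Fin (m + 1))
    (b : Fin (m + 1) → Euc m) :
    volume (convexHull ℝ (range (slide ε v p i b))) = volume (convexHull ℝ (range b)) := by
  have : range (slide ε v p i b) = (-(ε • perp v (b i - p))) +ᵥ range b := by
    rw [← image_vadd, ← range_comp]
    congr 1
    ext1 j
    simp [slide, sub_eq_neg_add]
  rw [this, convexHull_vadd, measure_vadd]

/-- The unnormalized density of `simplexDensityMeasure`. -/
def simplexDensity (c : ℝ) (f : Fin (m + 1) → Euc m → ℝ) (b : Fin (m + 1) → Euc m) : ℝ :=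
  c * (volume (convexHull ℝ (range b))).toReal * ∏ i, f i (b i)

lemma simplexDensity_le_slide {L c : ℝ} (hL : 0 ≤ L) (hc : 0 ≤ c)
    {f : Fin (m + 1) → Euc m → ℝ} (hf : ∀ i, IsLogLipschitz L (f i))
    {ε : ℝ} (hε0 : 0 ≤ ε) {v p : Euc m} {i : Fin (m + 1)} {b : Fin (m + 1) → Euc m}
    (hb : ‖perp v (b i - p)‖ ≤ 3) :
    Real.exp (-(3 * (m + 1) * L * ε)) * simplexDensity c f b ≤
      simplexDensity c f (slide ε v p i b) := by
  have key : ∏ j, f j (b j) ≤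
      Real.exp (3 * (m + 1) * L * ε) * ∏ j, f j (slide ε v p i b j) := by
    calc ∏ j, f j (b j) ≤ ∏ j, (Real.exp (L * (3 * ε)) * f j (slide ε v p i b j)) := by
          refine Finset.prod_le_prod (fun j _ => ((hf j).1 _).le) fun j _ => ?_
          refine ((hf j).2 _ (slide ε v p i b j)).trans ?_
          refine mul_le_mul_of_nonneg_right (Real.exp_le_exp.2 ?_) ((hf j).1 _).le
          refine mul_le_mul_of_nonneg_left ?_ hL
          simp only [slide, sub_sub_cancel, norm_smul, Real.norm_of_nonneg hε0]
          nlinarith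
      _ = _ := by
          rw [Finset.prod_mul_distrib, Finset.prod_const, ← Real.exp_nat_mul]
          congr 2
          simp
          ring
  rw [Real.exp_neg, inv_mul_le_iff₀ (Real.exp_pos _)]
  unfold simplexDensity
  rw [volume_convexHull_slide]
  calc _ ≤ c * (volume (convexHull ℝ (range b))).toReal *
        (Real.exp (3 * (m + 1) * L * ε) * ∏ j, f j (slide ε v p i b j)) := by gcongr
    _ = _ := by ring

/-- The linear part of `slide`. -/
def slideLinear (ε : ℝ) (v : Euc m) (i : Fin (m + 1)) :
    (Fin (m + 1) → Euc m) →L[ℝ] (Fin (m + 1) → Euc m) :=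
  ContinuousLinearMap.pi fun j =>
    ContinuousLinearMap.proj (R := ℝ) (φ := fun _ => Euc m) j -
      ε • (perp v).comp (ContinuousLinearMap.proj (R := ℝ) (φ := fun _ => Euc m) i)

lemma slideLinear_apply (ε : ℝ) (v : Euc m) (i j : Fin (m + 1)) (b : Fin (m + 1) → Euc m) :
    slideLinear ε v i b j = b j - ε • perp v (b i) := by
  simp [slideLinear]

lemma slide_eq (ε : ℝ) (v p : Euc m) (i : Fin (m + 1)) :
    slide ε v p i = fun b => slideLinear ε v i b + fun _ => ε • perp v p := by
  ext1 b
  ext1 j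
  simp only [slide, Pi.add_apply, slideLinear_apply, map_sub]
  module

lemma hasFDerivAt_slide (ε : ℝ) (v p : Euc m) (i : Fin (m + 1)) (b : Fin (m + 1) → Euc m) :
    HasFDerivAt (slide ε v p i) (slideLinear ε v i) b := by
  rw [slide_eq]
  exact (slideLinear ε v i).hasFDerivAt.add_const _

lemma det_id_sub_smul_perp (ε : ℝ) {v : Euc m} (hv : ‖v‖ = 1) :
    (1 - ε) * LinearMap.det (LinearMap.id - ε • (perp v : Euc m →ₗ[ℝ] Euc m)) = (1 - ε) ^ m := by
  let Q : Euc m →ₗ[ℝ] Euc m := LinearMap.transvection (-ε • (innerSL ℝ v).toLinearMap) v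
  have hQ : LinearMap.det Q = 1 - ε := by
    rw [LinearMap.transvection.det]
    simp [hv, sub_eq_add_neg]
  have hcomp : Q ∘ₗ (LinearMap.id - ε • (perp v : Euc m →ₗ[ℝ] Euc m)) =
      (1 - ε) • LinearMap.id := by
    ext1 x
    simp only [Q, LinearMap.comp_apply, LinearMap.transvection.apply]
    simp [inner_sub_right, inner_smul_right, inner_perp hv]
    simp only [perp_apply]
    module
  rw [← hQ, ← LinearMap.det_comp, hcomp, LinearMap.det_smul]
  simp [hQ]

lemma det_slideLinear (ε : ℝ) (v : Euc m) (i : Fin (m + 1)) :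
    (slideLinear ε v i).det =
      LinearMap.det (LinearMap.id - ε • (perp v : Euc m →ₗ[ℝ] Euc m)) := by
  let e : (Fin (m + 1) → Euc m) ≃ₗ[ℝ] (Fin (m + 1) → Euc m) :=
    { toFun := fun b j => if j = i then b j else b j - b i
      invFun := fun b j => if j = i then b j else b j + b i
      map_add' := fun b b' => funext fun j => by
        by_cases h : j = i
        · simp [h]
        · simp [h, add_sub_add_comm]
      map_smul' := fun r b => funext fun j => by
        by_cases h : j = i
        · simp [h]
        · simp [h, smul_sub]
      left_inv := fun b => funext fun j => by by_cases h : j = i <;> simp [h]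
      right_inv := fun b => funext fun j => by by_cases h : j = i <;> simp [h] }
  have he : ∀ b j, e b j = if j = i then b j else b j - b i := fun b j => rfl
  have he' : ∀ b j, e.symm b j = if j = i then b j else b j + b i := fun b j => rfl
  let g : Fin (m + 1) → Euc m →ₗ[ℝ] Euc m := fun j =>
    if j = i then LinearMap.id - ε • (perp v : Euc m →ₗ[ℝ] Euc m) else LinearMap.id
  have hconj : (e : _ →ₗ[ℝ] _) ∘ₗ (slideLinear ε v i).toLinearMap ∘ₗ (e.symm : _ →ₗ[ℝ] _) =
      LinearMap.pi fun j => g j ∘ₗ LinearMap.proj j := by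
    refine LinearMap.ext fun b => funext fun j => ?_
    by_cases h : j = i
    · subst h
      simp [he, he', g, slideLinear_apply]
    · simp [he, he', g, slideLinear_apply, h]
  rw [ContinuousLinearMap.det, ← LinearMap.det_conj _ e, hconj, LinearMap.det_pi,
    Finset.prod_eq_single i]
  · simp [g]
  · intro j _ h
    simp [g, h]
  · simp

/-- The matrix with columns `perp v (b j) + v`, where `j` runs over all indices but the last. -/
def ridgeMatrix (v : Euc m) (b : Fin (m + 1) → Euc m) : Matrix (Fin m) (Fin m) ℝ :=
  Matrix.of fun i j => (perp v (b j.castSucc) + v) i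

open Matrix in
lemma ridgeMatrix_mulVec (v : Euc m) (b : Fin (m + 1) → Euc m) (w : Fin m → ℝ) :
    ridgeMatrix v b *ᵥ w =
      WithLp.ofLp (∑ j, w j • perp v (b j.castSucc) + (∑ j, w j) • v) := by
  ext i
  simp only [ridgeMatrix, Matrix.mulVec, dotProduct, Matrix.of_apply, PiLp.add_apply,
    WithLp.ofLp_sum, WithLp.ofLp_smul, Pi.smul_apply,
    Finset.sum_apply, smul_eq_mul, Finset.sum_mul, ← Finset.sum_add_distrib]
  exact Finset.sum_congr rfl fun j _ => by ring

lemma add_smul_eq_zero_iff {v : Euc m} (hv : ‖v‖ = 1) {y : Euc m} (hy : ⟪v, y⟫ = 0) (a : ℝ) :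
    y + a • v = 0 ↔ y = 0 ∧ a = 0 := by
  constructor
  · intro h
    have ha : a = 0 := by
      have := congrArg (fun x => ⟪v, x⟫) h
      simpa [inner_add_right, inner_smul_right, hv, hy] using this
    subst ha
    exact ⟨by simpa using h, rfl⟩
  · rintro ⟨rfl, rfl⟩
    simp

lemma inner_sum_smul_perp {ι : Type*} (s : Finset ι) {v : Euc m} (hv : ‖v‖ = 1) (w : ι → ℝ)
    (x : ι → Euc m) : ⟪v, ∑ j ∈ s, w j • perp v (x j)⟫ = 0 := by
  simp [inner_sum, inner_smul_right, inner_perp hv]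

lemma det_ridgeMatrix_ne_zero_iff {v : Euc m} (hv : ‖v‖ = 1) (b : Fin (m + 1) → Euc m) :
    (ridgeMatrix v b).det ≠ 0 ↔ ∀ w : Fin m → ℝ, ∑ j, w j = 0 →
      ∑ j, w j • perp v (b j.castSucc) = 0 → w = 0 := by
  rw [Ne, ← Matrix.exists_mulVec_eq_zero_iff]
  push Not
  refine forall_congr' fun w => ?_
  have h0 : ∀ y : Euc m, y.ofLp = 0 ↔ y = 0 := fun y => WithLp.ofLp_eq_zero 2
  rw [ridgeMatrix_mulVec, Ne, Ne, h0 (_ + _),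
    add_smul_eq_zero_iff hv (inner_sum_smul_perp _ hv w fun j => b j.castSucc)]
  tauto

lemma det_ridgeMatrix_smul_ne_zero_iff {v : Euc m} (hv : ‖v‖ = 1) (b : Fin (m + 1) → Euc m)
    {t : ℝ} (ht : t ≠ 0) :
    (ridgeMatrix v (t • b)).det ≠ 0 ↔ (ridgeMatrix v b).det ≠ 0 := by
  rw [det_ridgeMatrix_ne_zero_iff hv, det_ridgeMatrix_ne_zero_iff hv]
  refine forall₂_congr fun w _ => ?_
  have : ∑ j, w j • perp v ((t • b) j.castSucc) = t • ∑ j, w j • perp v (b j.castSucc) := by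
    simp [Finset.smul_sum, smul_comm t]
  rw [this, smul_eq_zero_iff_right ht]

/-- A hyperplane with normal `v` contains affinely independent points with centroid zero. -/
lemma exists_centered_affineIndependent {v : Euc m} (hv : ‖v‖ = 1) :
    ∃ e : Fin m → Euc m, (∀ j, perp v (e j) = e j) ∧ ∑ j, e j = 0 ∧
      ∀ w : Fin m → ℝ, ∑ j, w j = 0 → ∑ j, w j • e j = 0 → w = 0 := by
  have hv0 : v ≠ 0 := by rintro rfl; simp at hv
  obtain ⟨n, rfl⟩ : ∃ n, m = n + 1 := by
    cases m with
    | zero => exact absurd (Subsingleton.elim v 0) hv0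
    | succ n => exact ⟨n, rfl⟩
  have : Fact (Module.finrank ℝ (Euc (n + 1)) = n + 1) := ⟨by simp⟩
  obtain ⟨a⟩ := AffineBasis.exists_affineBasis_of_finiteDimensional (ι := Fin (n + 1)) (k := ℝ)
    (P := (ℝ ∙ v)ᗮ) (by rw [Submodule.finrank_orthogonal_span_singleton (n := n) hv0]; simp)
  have hperp : ∀ x ∈ (ℝ ∙ v)ᗮ, perp v x = x := fun x hx => by
    rw [perp_apply, Submodule.mem_orthogonal_singleton_iff_inner_right.1 hx]; simp
  let z : (ℝ ∙ v)ᗮ := ((n + 1 : ℝ)⁻¹) • ∑ j, a j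
  refine ⟨fun j => ((a j - z : (ℝ ∙ v)ᗮ) : Euc (n + 1)), fun j => hperp _ (Subtype.mem _),
    ?_, fun w hw h => ?_⟩
  · rw [← Submodule.coe_sum, Finset.sum_sub_distrib]
    have : ((n : ℝ) + 1) ≠ 0 := by positivity
    have hz : ∑ _j : Fin (n + 1), z = ∑ j, a j := by
      rw [Finset.sum_const, Finset.card_fin, ← Nat.cast_smul_eq_nsmul ℝ]
      simp [z, smul_smul, this]
    simp [hz]
  · have h' : ∑ j, w j • a j = 0 := by
      have : ∑ j, w j • (a j - z) = 0 := by
        apply Subtype.ext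
        simpa using h
      simpa [smul_sub, ← Finset.sum_smul, hw] using this
    funext j
    exact affineIndependent_iff.1 a.ind Finset.univ w hw h' j (Finset.mem_univ _)

lemma finite_det_ridgeMatrix_line_eq_zero (v : Euc m) {e : Fin (m + 1) → Euc m}
    (he : (ridgeMatrix v e).det ≠ 0) (b : Fin (m + 1) → Euc m) :
    {s : ℝ | (ridgeMatrix v (e + s • b)).det = 0}.Finite := by
  let q : Polynomial ℝ := Matrix.det (Matrix.of fun i j : Fin m =>
    Polynomial.C (ridgeMatrix v e i j) + Polynomial.X * Polynomial.C (perp v (b j.castSucc) i))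
  have hq : ∀ s, q.eval s = (ridgeMatrix v (e + s • b)).det := fun s => by
    rw [← Polynomial.coe_evalRingHom, RingHom.map_det]
    congr 1
    ext i j
    simp [ridgeMatrix]
    ring
  have hq0 : q ≠ 0 := fun h => he (by simpa [h] using (hq 0).symm)
  refine (Polynomial.finite_setOfPred_isRoot hq0).subset fun s hs => ?_
  exact (hq s).trans hs

lemma continuous_ridgeMatrix (v : Euc m) : Continuous (ridgeMatrix v) := by
  refine continuous_matrix fun i j => ?_
  simp only [ridgeMatrix, Matrix.of_apply]
  fun_prop

lemma ae_det_ridgeMatrix_ne_zero {v : Euc m} (hv : ‖v‖ = 1) :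
    ∀ᵐ b : Fin (m + 1) → Euc m, (ridgeMatrix v b).det ≠ 0 := by
  obtain ⟨e, he, -, hind⟩ := exists_centered_affineIndependent hv
  let e' : Fin (m + 1) → Euc m := Fin.snoc e 0
  have he' : (ridgeMatrix v e').det ≠ 0 := by
    rw [det_ridgeMatrix_ne_zero_iff hv]
    simpa [e', he] using hind
  refine ae_mem_of_ae_add_linearMap_mem (LinearMap.toSpanSingleton ℝ _ e') volume volume
    (s := {b | (ridgeMatrix v b).det ≠ 0}) ?_ fun b => ?_
  · exact (isOpen_ne_fun (continuous_ridgeMatrix v).matrix_det continuous_const).measurableSet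
  · refine (((finite_det_ridgeMatrix_line_eq_zero v he' b).image Inv.inv).insert
      0).countable.ae_notMem _ |>.mono fun t ht => ?_
    simp only [mem_insert_iff, not_or] at ht
    obtain ⟨ht0, ht⟩ := ht
    have : b + t • e' = t • (e' + t⁻¹ • b) := by
      rw [smul_add, smul_inv_smul₀ ht0]
      exact add_comm _ _
    rw [LinearMap.toSpanSingleton_apply, mem_ofPred_eq, this,
      det_ridgeMatrix_smul_ne_zero_iff hv _ ht0]
    exact fun h => ht ⟨t⁻¹, h, inv_inv t⟩

lemma weights_unique {v p : Euc m} (hv : ‖v‖ = 1) {b : Fin (m + 1) → Euc m}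
    (hb : (ridgeMatrix v b).det ≠ 0) {lam lam' : Fin (m + 1) → ℝ} (h : lam ∈ ridgeWeights m)
    (h' : lam' ∈ ridgeWeights m) (hlam : perp v (∑ j, lam j • b j - p) = 0)
    (hlam' : perp v (∑ j, lam' j • b j - p) = 0) : lam = lam' := by
  rw [det_ridgeMatrix_ne_zero_iff hv] at hb
  obtain ⟨-, h1, h2⟩ := h
  obtain ⟨-, h1', h2'⟩ := h'
  rw [map_sub, sub_eq_zero] at hlam hlam'
  rw [Fin.sum_univ_castSucc, h1, add_zero] at h2
  rw [Fin.sum_univ_castSucc, h1', add_zero] at h2'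
  rw [Fin.sum_univ_castSucc, h1, zero_smul, add_zero] at hlam
  rw [Fin.sum_univ_castSucc, h1', zero_smul, add_zero] at hlam'
  simp only [map_sum, map_smul] at hlam hlam'
  have := hb (fun j => lam j.castSucc - lam' j.castSucc) (by simp [h2, h2'])
    (by simp [sub_smul, hlam, hlam'])
  funext j
  refine Fin.lastCases (by rw [h1, h1']) (fun j => ?_) j
  exact sub_eq_zero.1 (congrFun this j)

lemma volume_convexHull_pos {b : Fin (m + 1) → Euc m} (hb : AffineIndependent ℝ b) :
    0 < volume (convexHull ℝ (range b)) := by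
  have : affineSpan ℝ (range b) = ⊤ := by
    rw [hb.affineSpan_eq_top_iff_card_eq_finrank_add_one]
    simp
  exact Measure.measure_pos_of_nonempty_interior _
    (interior_convexHull_nonempty_iff_affineSpan_eq_top.2 this)

lemma volume_convexHull_ne_top (b : Fin (m + 1) → Euc m) :
    volume (convexHull ℝ (range b)) ≠ ∞ :=
  ((finite_range b).isCompact_convexHull ℝ).measure_lt_top.ne

/-- By Cramer's rule, this sign condition forces the solution of the linear system for the weights
to be positive. -/
lemma exists_weights_of_cramer_pos {v p : Euc m} (hv : ‖v‖ = 1) {b : Fin (m + 1) → Euc m}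
    (hb : ∀ j, 0 < (ridgeMatrix v b).det * (ridgeMatrix v b).cramer (perp v p + v).ofLp j) :
    ∃ lam ∈ ridgeWeights m, perp v (∑ j, lam j • b j - p) = 0 := by
  set A := ridgeMatrix v b with hA
  have hm : 0 < m := by
    rcases Nat.eq_zero_or_pos m with rfl | h
    · rw [Subsingleton.elim v 0] at hv
      simp at hv
    · exact h
  have hdet : A.det ≠ 0 := fun h => by simpa [h] using hb ⟨0, hm⟩
  let w : Fin m → ℝ := A.det⁻¹ • A.cramer (perp v p + v).ofLp
  have hw0 : ∀ j, 0 ≤ w j := fun j => by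
    have : w j = (A.det ^ 2)⁻¹ * (A.det * A.cramer (perp v p + v).ofLp j) := by
      simp only [w, Pi.smul_apply, smul_eq_mul]
      field_simp
    rw [this]
    exact mul_nonneg (by positivity) (hb j).le
  have hw : A.mulVec w = (perp v p + v).ofLp := by
    rw [Matrix.mulVec_smul, Matrix.mulVec_cramer, smul_smul, inv_mul_cancel₀ hdet, one_smul]
  rw [hA, ridgeMatrix_mulVec] at hw
  have hw' := WithLp.ofLp_injective 2 hw
  have key : (∑ j, w j • perp v (b j.castSucc) - perp v p) + (∑ j, w j - 1) • v = 0 := by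
    rw [sub_smul, one_smul, sub_add_sub_comm, hw', sub_self]
  rw [add_smul_eq_zero_iff hv (by
    rw [inner_sub_right, inner_perp hv, inner_sum_smul_perp _ hv, sub_zero])] at key
  refine ⟨Fin.snoc w 0, ⟨fun j => ?_, by simp, ?_⟩, ?_⟩
  · refine Fin.lastCases (by simp) (fun j => ?_) j
    simpa using hw0 j
  · rw [Fin.sum_univ_castSucc]
    simpa using sub_eq_zero.1 key.2
  · rw [Fin.sum_univ_castSucc]
    simpa using key.1

lemma exists_nondegenerate_simplex {v p : Euc m} (hv : ‖v‖ = 1) :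
    ∃ b : Fin (m + 1) → Euc m, (∀ i j, dist (b i) (b j) < 3) ∧ AffineIndependent ℝ b ∧
      ∀ j, 0 < (ridgeMatrix v b).det * (ridgeMatrix v b).cramer (perp v p + v).ofLp j := by
  obtain ⟨e, he, hsum, hind⟩ := exists_centered_affineIndependent hv
  obtain ⟨r, hr0, hr1, hre⟩ : ∃ r : ℝ, 0 < r ∧ r ≤ 1 ∧ ∀ j, r * ‖e j‖ ≤ 1 := by
    have hS : 0 ≤ ∑ j, ‖e j‖ := Finset.sum_nonneg fun _ _ => norm_nonneg _
    have hS' : 0 < 1 + ∑ j, ‖e j‖ := add_pos_of_pos_of_nonneg one_pos hS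
    refine ⟨(1 + ∑ j, ‖e j‖)⁻¹, inv_pos.2 hS', inv_le_one_of_one_le₀ (by linarith), fun j => ?_⟩
    rw [inv_mul_le_one₀ hS']
    exact (Finset.single_le_sum (f := fun j => ‖e j‖) (fun _ _ => norm_nonneg _)
      (Finset.mem_univ j)).trans (by linarith)
  obtain ⟨b, hbc, hbl⟩ : ∃ b : Fin (m + 1) → Euc m,
      (∀ j : Fin m, b j.castSucc = p + r • e j) ∧ b (Fin.last m) = p + r • v :=
    ⟨Fin.snoc (α := fun _ => Euc m) (fun j => p + r • e j) (p + r • v),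
      fun j => Fin.snoc_castSucc .., Fin.snoc_last ..⟩
  have hbp : ∀ j, ‖b j - p‖ ≤ 1 := by
    refine Fin.lastCases ?_ fun j => ?_
    · rwa [hbl, add_sub_cancel_left, norm_smul, hv, mul_one, Real.norm_of_nonneg hr0.le]
    · rw [hbc, add_sub_cancel_left, norm_smul, Real.norm_of_nonneg hr0.le]
      exact hre j
  have hkernel : ∀ w : Fin m → ℝ, ∑ j, w j • perp v (b j.castSucc) =
      (∑ j, w j) • perp v p + r • ∑ j, w j • e j := fun w => by
    simp only [hbc, map_add, map_smul, he, smul_add, Finset.sum_add_distrib, Finset.sum_smul,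
      Finset.smul_sum, smul_comm r]
  have hdet : (ridgeMatrix v b).det ≠ 0 := by
    rw [det_ridgeMatrix_ne_zero_iff hv]
    intro w hw h
    rw [hkernel, hw, zero_smul, zero_add, smul_eq_zero_iff_right hr0.ne'] at h
    exact hind w hw h
  refine ⟨b, fun i j => ?_, ?_, fun j => ?_⟩
  · calc dist (b i) (b j) ≤ dist (b i) p + dist p (b j) := dist_triangle _ _ _
      _ ≤ 1 + 1 := by
        rw [dist_eq_norm, dist_comm, dist_eq_norm]
        exact add_le_add (hbp i) (hbp j)
      _ < 3 := by norm_num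
  · rw [affineIndependent_iff_of_fintype]
    intro w hw h
    rw [Finset.weightedVSub_eq_linear_combination _ hw] at h
    have hwl : w (Fin.last m) = 0 := by
      have h3 : ∑ j, w j • (b j - p) = 0 := by
        simp [smul_sub, ← Finset.sum_smul, hw, h]
      have h4 := congrArg (fun x => ⟪v, x⟫) h3
      have h5 : ∀ j, ⟪v, e j⟫ = 0 := fun j => by rw [← he, inner_perp hv]
      simpa [Fin.sum_univ_castSucc, hbc, hbl, inner_add_right, inner_sum, inner_smul_right, h5,
        hv, hr0.ne'] using h4
    rw [Fin.sum_univ_castSucc, hwl, add_zero] at hw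
    rw [Fin.sum_univ_castSucc, hwl, zero_smul, add_zero] at h
    have h6 := (det_ridgeMatrix_ne_zero_iff hv b).1 hdet (fun j => w j.castSucc) hw (by
      simpa using congrArg (perp v) h)
    exact Fin.lastCases hwl fun j => congrFun h6 j
  · have hm : (0 : ℝ) < m := by exact_mod_cast j.pos
    have hrhs : (perp v p + v).ofLp = (ridgeMatrix v b).mulVec fun _ => (m : ℝ)⁻¹ := by
      rw [ridgeMatrix_mulVec, hkernel, ← Finset.smul_sum, hsum]
      simp [hm.ne']
    rw [hrhs, Matrix.cramer_eq_adjugate_mulVec, Matrix.mulVec_mulVec, Matrix.adjugate_mul,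
      Matrix.smul_mulVec, Matrix.one_mulVec, Pi.smul_apply, smul_eq_mul, ← mul_assoc]
    have := mul_self_pos.2 hdet
    positivity

/-- The event `ridgeEvent ℓ` contains a nonempty open set of nondegenerate simplices. -/
lemma exists_isOpen_subset_ridgeEvent {v p : Euc m} (hv : ‖v‖ = 1)
    {ℓ : AffineSubspace ℝ (Euc m)} (hℓ : ∀ x, x ∈ ℓ ↔ perp v (x - p) = 0) :
    ∃ U : Set (Fin (m + 1) → Euc m), IsOpen U ∧ U.Nonempty ∧ U ⊆ ridgeEvent ℓ ∧
      ∀ b ∈ U, AffineIndependent ℝ b := by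
  refine ⟨{b | ∀ i j, dist (b i) (b j) < 3} ∩ ({b | AffineIndependent ℝ b} ∩
    {b | ∀ j, 0 < (ridgeMatrix v b).det * (ridgeMatrix v b).cramer (perp v p + v).ofLp j}),
    ?_, ?_, ?_, fun b hb => hb.2.1⟩
  · refine IsOpen.inter ?_ (isOpen_setOfPred_affineIndependent.inter ?_)
    · simp only [ofPred_forall]
      exact isOpen_iInter_of_finite fun i => isOpen_iInter_of_finite fun j =>
        isOpen_lt (by fun_prop) continuous_const
    · simp only [ofPred_forall]
      have h1 := continuous_ridgeMatrix v
      exact isOpen_iInter_of_finite fun j => isOpen_lt continuous_const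
        (h1.matrix_det.mul ((continuous_apply j).comp (h1.matrix_cramer continuous_const)))
  · obtain ⟨b, h1, h2, h3⟩ := exists_nondegenerate_simplex (p := p) hv
    exact ⟨b, h1, h2, h3⟩
  · rintro b ⟨h1, -, h2⟩
    obtain ⟨lam, hlam, h⟩ := exists_weights_of_cramer_pos hv h2
    exact mem_ridgeEvent_iff.2 ⟨fun i j => (h1 i j).le, lam, hlam, (hℓ _).2 h⟩

lemma slide_injective {ε : ℝ} (hε : ε < 1) {v : Euc m} (hv : ‖v‖ = 1) (p : Euc m)
    (i : Fin (m + 1)) : Function.Injective (slide ε v p i) := by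
  intro b b' h
  have hj : ∀ j, b j - b' j = ε • perp v (b i - b' i) := fun j => by
    have := congrFun h j
    simp only [slide] at this
    have e : b i - b' i = (b i - p) - (b' i - p) := by abel
    rw [e, map_sub, smul_sub, sub_eq_sub_iff_sub_eq_sub.1 this]
  have hi : (1 - ε) • perp v (b i - b' i) = 0 := by
    rw [sub_smul, one_smul, sub_eq_zero]
    conv_lhs => rw [hj i, map_smul, perp_perp hv]
  have h0 : perp v (b i - b' i) = 0 := (smul_eq_zero_iff_right (by linarith)).1 hi
  funext j
  simpa [h0, sub_eq_zero] using hj j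

lemma simplexDensityMeasure_apply (c : ℝ) (f : Fin (m + 1) → Euc m → ℝ)
    {s : Set (Fin (m + 1) → Euc m)} (hs : MeasurableSet s) :
    simplexDensityMeasure c f s = ∫⁻ b in s, ENNReal.ofReal (simplexDensity c f b) := by
  rw [simplexDensityMeasure, withDensity_apply _ hs]
  rfl

lemma continuous_of_isLogLipschitz {L : ℝ} {g : Euc m → ℝ} (hg : IsLogLipschitz L g) :
    Continuous g := by
  rw [continuous_iff_continuousAt]
  intro y
  have hlow : ∀ x, Real.exp (-(L * ‖y - x‖)) * g y ≤ g x := fun x => by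
    rw [Real.exp_neg, inv_mul_le_iff₀ (Real.exp_pos _)]
    exact hg.2 y x
  have h1 : Filter.Tendsto (fun x => Real.exp (-(L * ‖y - x‖)) * g y) (nhds y) (nhds (g y)) := by
    have : Continuous fun x => Real.exp (-(L * ‖y - x‖)) * g y := by fun_prop
    simpa using this.tendsto y
  have h2 : Filter.Tendsto (fun x => Real.exp (L * ‖x - y‖) * g y) (nhds y) (nhds (g y)) := by
    have : Continuous fun x => Real.exp (L * ‖x - y‖) * g y := by fun_prop
    simpa using this.tendsto y
  exact tendsto_of_tendsto_of_tendsto_of_le_of_le h1 h2 hlow fun x => hg.2 x y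

lemma convexHull_range_eq_image_stdSimplex (b : Fin (m + 1) → Euc m) :
    convexHull ℝ (range b) =
      (fun lam : Fin (m + 1) → ℝ => ∑ i, lam i • b i) '' stdSimplex ℝ (Fin (m + 1)) := by
  apply Subset.antisymm
  · refine convexHull_min ?_ ?_
    · rintro _ ⟨i, rfl⟩
      exact ⟨Pi.single i 1, single_mem_stdSimplex ℝ i, by simp [Pi.single_apply]⟩
    · exact (convex_stdSimplex ℝ _).is_linear_image (f := fun lam => ∑ i, lam i • b i)
        ⟨fun x y => by simp [add_smul, Finset.sum_add_distrib],
          fun c x => by simp [Finset.smul_sum, smul_smul]⟩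
  · rintro _ ⟨lam, ⟨h0, h1⟩, rfl⟩
    exact (convex_convexHull ℝ _).sum_mem (fun i _ => h0 i) h1
      fun i _ => subset_convexHull ℝ _ (mem_range_self i)

lemma measurable_volume_convexHull_range :
    Measurable fun b : Fin (m + 1) → Euc m => volume (convexHull ℝ (range b)) := by
  have hset : {q : (Fin (m + 1) → Euc m) × Euc m | q.2 ∈ convexHull ℝ (range q.1)} =
      Prod.snd '' {q : stdSimplex ℝ (Fin (m + 1)) × ((Fin (m + 1) → Euc m) × Euc m) |
        ∑ i, q.1.1 i • q.2.1 i = q.2.2} := by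
    ext ⟨b, x⟩
    rw [mem_ofPred_eq, convexHull_range_eq_image_stdSimplex]
    simp
  have hclosed : IsClosed {q : (Fin (m + 1) → Euc m) × Euc m |
      q.2 ∈ convexHull ℝ (range q.1)} := by
    rw [hset]
    have : CompactSpace (stdSimplex ℝ (Fin (m + 1))) :=
      isCompact_iff_compactSpace.1 (isCompact_stdSimplex ℝ _)
    refine isClosedMap_snd_of_compactSpace _ (isClosed_eq ?_ (by fun_prop))
    exact continuous_finsetSum _ fun i _ =>
      ((continuous_apply i).comp (continuous_subtype_val.comp continuous_fst)).smul
        ((continuous_apply i).comp (continuous_fst.comp continuous_snd))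
  exact measurable_measure_prodMk_left hclosed.measurableSet

lemma measurable_simplexDensity (c : ℝ) {f : Fin (m + 1) → Euc m → ℝ}
    (hf : ∀ i, Measurable (f i)) : Measurable (simplexDensity c f) := by
  refine Measurable.mul (measurable_volume_convexHull_range.ennreal_toReal.const_mul c) ?_
  exact Finset.measurable_fun_prod _ fun i _ => (hf i).comp (measurable_pi_apply i)

lemma simplexDensity_pos {L c : ℝ} (hc : 0 < c) {f : Fin (m + 1) → Euc m → ℝ}
    (hf : ∀ i, IsLogLipschitz L (f i)) {b : Fin (m + 1) → Euc m} (hb : AffineIndependent ℝ b) :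
    0 < simplexDensity c f b :=
  mul_pos (mul_pos hc (ENNReal.toReal_pos (volume_convexHull_pos hb).ne'
    (volume_convexHull_ne_top b))) (Finset.prod_pos fun i _ => (hf i).1 _)

lemma simplexDensityMeasure_pos {L c : ℝ} (hc : 0 < c) {f : Fin (m + 1) → Euc m → ℝ}
    (hf : ∀ i, IsLogLipschitz L (f i)) {U : Set (Fin (m + 1) → Euc m)} (hU : IsOpen U)
    (hne : U.Nonempty) (hind : ∀ b ∈ U, AffineIndependent ℝ b) :
    0 < simplexDensityMeasure c f U := by
  rw [simplexDensityMeasure_apply c f hU.measurableSet, setLIntegral_pos_iff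
    (measurable_simplexDensity c fun i => (continuous_of_isLogLipschitz (hf i)).measurable
      ).ennreal_ofReal]
  refine (hU.measure_pos volume hne).trans_le (measure_mono fun b hb => ⟨?_, hb⟩)
  simpa using simplexDensity_pos hc hf (hind b hb)

lemma le_simplexDensityMeasure_image_slide {L c : ℝ} (hL : 0 ≤ L) (hc : 0 ≤ c)
    {f : Fin (m + 1) → Euc m → ℝ} (hf : ∀ i, IsLogLipschitz L (f i))
    {ε : ℝ} (hε0 : 0 ≤ ε) (hε1 : ε < 1) {v p : Euc m} (hv : ‖v‖ = 1)
    {ℓ : AffineSubspace ℝ (Euc m)} (hℓ : ∀ x, x ∈ ℓ ↔ perp v (x - p) = 0) (i : Fin (m + 1)) :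
    ENNReal.ofReal ((1 - ε) ^ m * Real.exp (-(3 * (m + 1) * L * ε))) *
      simplexDensityMeasure c f (ridgeEvent ℓ) ≤
      simplexDensityMeasure c f (slide ε v p i '' ridgeEvent ℓ) := by
  have hS := (isClosed_ridgeEvent ℓ).measurableSet
  have hinj := (slide_injective hε1 hv p i).injOn (s := ridgeEvent ℓ)
  have hderiv : ∀ b ∈ ridgeEvent ℓ,
      HasFDerivWithinAt (slide ε v p i) (slideLinear ε v i) (ridgeEvent ℓ) b :=
    fun b _ => (hasFDerivAt_slide ε v p i b).hasFDerivWithinAt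
  have hdet : (1 - ε) ^ m ≤ |(slideLinear ε v i).det| := by
    have h := det_id_sub_smul_perp ε hv
    rw [← det_slideLinear ε v i] at h
    have h1 : 0 < 1 - ε := by linarith
    rw [← h]
    calc _ ≤ (1 - ε) * |(slideLinear ε v i).det| := by gcongr; exact le_abs_self _
      _ ≤ 1 * |(slideLinear ε v i).det| := by gcongr; linarith
      _ = _ := one_mul _
  rw [simplexDensityMeasure_apply c f (measurable_image_of_fderivWithin hS hderiv hinj),
    lintegral_image_eq_lintegral_abs_det_fderiv_mul volume hS hderiv hinj,
    simplexDensityMeasure_apply c f hS, ← lintegral_const_mul' _ _ ENNReal.ofReal_ne_top]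
  refine setLIntegral_mono' hS fun b hb => ?_
  rw [ENNReal.ofReal_mul (pow_nonneg (by linarith) _), mul_assoc,
    ← ENNReal.ofReal_mul (Real.exp_pos _).le]
  gcongr
  exact simplexDensity_le_slide hL hc hf hε0 (norm_perp_sub_le_of_mem_ridgeEvent hv hℓ i hb)

lemma slide_retention_bound (m : ℕ) {L : ℝ} (hL : 1 ≤ L) {ε : ℝ}
    (hε : ε = 1 / (120 * ((m : ℝ) + 1) ^ 2 * L)) :
    1 - 1 / (30 * (m + 1)) ≤ (1 - ε) ^ m * Real.exp (-(3 * (m + 1) * L * ε)) := by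
  have hm : (0 : ℝ) ≤ m := Nat.cast_nonneg m
  have hε0 : 0 < ε := by rw [hε]; positivity
  have ha : 3 * (m + 1) * L * ε = 1 / (40 * (m + 1)) := by
    rw [hε]; field_simp; norm_num
  have hmε : m * ε ≤ 1 / (120 * (m + 1)) := by
    rw [hε, mul_one_div, div_le_div_iff₀ (by positivity) (by positivity)]
    nlinarith [mul_nonneg hm (sub_nonneg.2 hL), mul_nonneg (mul_nonneg hm hm) (sub_nonneg.2 hL)]
  have hsplit : 1 / (30 * ((m : ℝ) + 1)) = 1 / (40 * (m + 1)) + 1 / (120 * (m + 1)) := by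
    field_simp; norm_num
  have h40 : 1 / (40 * ((m : ℝ) + 1)) ≤ 1 := by
    rw [div_le_one (by positivity)]; linarith
  have hε1 : ε ≤ 1 := by
    rw [hε, div_le_one (by positivity)]
    nlinarith [sq_nonneg (m : ℝ)]
  have hpow : 1 - m * ε ≤ (1 - ε) ^ m := by
    have := one_add_mul_le_pow (a := -ε) (by linarith) m
    simpa [sub_eq_add_neg] using this
  have hexp : 1 - 1 / (40 * ((m : ℝ) + 1)) ≤ Real.exp (-(3 * (m + 1) * L * ε)) := by
    rw [ha]
    have := Real.add_one_le_exp (-(1 / (40 * ((m : ℝ) + 1))))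
    linarith
  calc 1 - 1 / (30 * ((m : ℝ) + 1))
      ≤ (1 - m * ε) * (1 - 1 / (40 * (m + 1))) := by
        have : 0 ≤ m * ε * (1 / (40 * ((m : ℝ) + 1))) := by positivity
        nlinarith
    _ ≤ (1 - ε) ^ m * (1 - 1 / (40 * (m + 1))) :=
        mul_le_mul_of_nonneg_right hpow (by linarith)
    _ ≤ _ := mul_le_mul_of_nonneg_left hexp (pow_nonneg (by linarith) _)

/-- lower bound for the convex coefficients on the ridge.
With `d = m + 1`: let `b₁,…,b_d ∈ ℝ^{d-1}` have joint density proportional to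
`vol_{d-1}(conv(b₁,…,b_d)) ∏ᵢ μ̄ᵢ(bᵢ)` with each `μ̄ᵢ` an `L`-log-Lipschitz density,
`L ≥ 1`.  Fix a line `ℓ ⊆ ℝ^{d-1}`; conditionally on the event `D'` (all pairwise
distances ≤ 3) and `ℓ ∩ conv(b₁,…,b_{d-1}) ≠ ∅`, with probability at least `0.95` the
convex coefficients `λ` of the point `ℓ ∩ conv(b₁,…,b_{d-1})` all satisfy
`λ_i ≥ 1/(120 d² L)`. -/
theorem stmt_9 (m : ℕ) (L : ℝ) (hL : 1 ≤ L) (c : ℝ) (hc : 0 < c)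
    (f : Fin (m + 1) → Euc m → ℝ) (hf : ∀ i, IsLogLipschitz L (f i))
    (hnorm : ∀ i, ∫⁻ x, ENNReal.ofReal (f i x) = 1)
    [IsProbabilityMeasure (simplexDensityMeasure c f)]
    (ℓ : AffineSubspace ℝ (Euc m)) (hℓne : (ℓ : Set (Euc m)).Nonempty)
    (hℓdim : Module.finrank ℝ ℓ.direction = 1) :
    (19/20 : ℝ≥0∞) ≤
      (simplexDensityMeasure c f)[|
        {b | ∀ i j, dist (b i) (b j) ≤ 3} ∩
        {b | ((ℓ : Set (Euc m)) ∩
          convexHull ℝ (b '' {i | i ≠ Fin.last m})).Nonempty}]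
      {b | ∀ lam : Fin (m + 1) → ℝ,
        (∀ i, 0 ≤ lam i) → lam (Fin.last m) = 0 → ∑ i, lam i = 1 →
        (∑ i, lam i • b i) ∈ (ℓ : Set (Euc m)) →
        ∀ i, i ≠ Fin.last m → 1 / (120 * ((m : ℝ) + 1) ^ 2 * L) ≤ lam i} := by
  obtain ⟨v, p, hv, hℓ⟩ := exists_perp_description ℓ hℓne hℓdim
  set μ := simplexDensityMeasure c f with hμ
  set ε : ℝ := 1 / (120 * ((m : ℝ) + 1) ^ 2 * L) with hε
  have hm : (0 : ℝ) ≤ m := Nat.cast_nonneg m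
  have hε0 : 0 ≤ ε := by positivity
  have hε1 : ε < 1 := by
    rw [hε, div_lt_one (by positivity)]
    nlinarith [sq_nonneg (m : ℝ)]
  change _ ≤ μ[|ridgeEvent ℓ] _
  have hS := (isClosed_ridgeEvent ℓ).measurableSet
  set G : Set (Fin (m + 1) → Euc m) := {b | ∀ lam : Fin (m + 1) → ℝ,
        (∀ i, 0 ≤ lam i) → lam (Fin.last m) = 0 → ∑ i, lam i = 1 →
        (∑ i, lam i • b i) ∈ (ℓ : Set (Euc m)) →
        ∀ i, i ≠ Fin.last m → ε ≤ lam i} with hG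
  have hpos : 0 < μ.real (ridgeEvent ℓ) := by
    obtain ⟨U, hU, hne, hUS, hind⟩ := exists_isOpen_subset_ridgeEvent hv hℓ
    exact ENNReal.toReal_pos ((simplexDensityMeasure_pos hc hf hU hne hind).trans_le
      (measure_mono hUS)).ne' (measure_ne_top _ _)
  have himage : ∀ i : Fin m, μ.real (ridgeEvent ℓ \ slide ε v p i.castSucc '' ridgeEvent ℓ) ≤
      1 / (30 * (m + 1)) * μ.real (ridgeEvent ℓ) := fun i => by
    have hmeas : MeasurableSet (slide ε v p i.castSucc '' ridgeEvent ℓ) :=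
      measurable_image_of_fderivWithin hS
        (fun b _ => (hasFDerivAt_slide ε v p i.castSucc b).hasFDerivWithinAt)
        (slide_injective hε1 hv p i.castSucc).injOn
    rw [measureReal_sdiff (by
      rintro _ ⟨b, hb, rfl⟩
      exact slide_mem_ridgeEvent hε0 hε1.le hv hℓ i.castSucc_ne_last hb) hmeas]
    have h := ENNReal.toReal_mono (measure_ne_top μ _)
      (le_simplexDensityMeasure_image_slide (by linarith) hc.le hf hε0 hε1 hv hℓ i.castSucc)
    rw [ENNReal.toReal_mul, ENNReal.toReal_ofReal
      (mul_nonneg (pow_nonneg (by linarith) _) (Real.exp_pos _).le)] at h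
    have h' := mul_le_mul_of_nonneg_right (slide_retention_bound m hL hε) hpos.le
    change _ * μ.real _ ≤ μ.real _ at h
    linarith
  have hnull : μ.real {b | ¬ (ridgeMatrix v b).det ≠ 0} = 0 := by
    have : μ {b | ¬ (ridgeMatrix v b).det ≠ 0} = 0 :=
      withDensity_absolutelyContinuous _ _ (ae_iff.1 (ae_det_ridgeMatrix_ne_zero hv))
    rw [Measure.real, this, ENNReal.toReal_zero]
  have hcover : ridgeEvent ℓ ⊆ (ridgeEvent ℓ ∩ G) ∪ ({b | ¬ (ridgeMatrix v b).det ≠ 0} ∪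
      ⋃ i : Fin m, ridgeEvent ℓ \ slide ε v p i.castSucc '' ridgeEvent ℓ) := by
    intro b hb
    by_contra hcon
    simp only [mem_union, not_or, mem_iUnion, not_exists, mem_sdiff, not_and, not_not,
      mem_ofPred_eq] at hcon
    obtain ⟨hbG, hdet, himg⟩ := hcon
    refine hbG ⟨hb, fun lam h0 h1 h2 hmem i hi => ?_⟩
    obtain ⟨j, rfl⟩ := Fin.exists_castSucc_eq.2 hi
    obtain ⟨b', hb', rfl⟩ := himg j hb
    obtain ⟨-, lam', hlam', hmem'⟩ := mem_ridgeEvent_iff.1 hb'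
    obtain ⟨lam'', hlam'', hmem'', hle⟩ :=
      exists_weights_slide hε0 hε1.le hv hi hlam' ((hℓ _).1 hmem')
    rwa [weights_unique hv hdet ⟨h0, h1, h2⟩ hlam'' ((hℓ _).1 hmem) hmem'']
  have hreal : 19 / 20 * μ.real (ridgeEvent ℓ) ≤ μ.real (ridgeEvent ℓ ∩ G) := by
    have h1 := (measureReal_mono hcover (measure_ne_top μ _)).trans (measureReal_union_le _ _)
    have h2 := measureReal_union_le (μ := μ) {b | ¬ (ridgeMatrix v b).det ≠ 0}
      (⋃ i : Fin m, ridgeEvent ℓ \ slide ε v p i.castSucc '' ridgeEvent ℓ)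
    have h3 := (measureReal_iUnion_fintype_le (μ := μ) fun i : Fin m =>
      ridgeEvent ℓ \ slide ε v p i.castSucc '' ridgeEvent ℓ).trans
      (Finset.sum_le_sum fun i _ => himage i)
    rw [Finset.sum_const, Finset.card_fin, nsmul_eq_mul, ← mul_assoc] at h3
    have h4 : m * (1 / (30 * ((m : ℝ) + 1))) ≤ 1 / 20 := by
      rw [mul_one_div, div_le_div_iff₀ (by positivity) (by positivity)]
      linarith
    have h5 := mul_le_mul_of_nonneg_right h4 hpos.le
    linarith
  rw [ProbabilityTheory.cond_apply hS, ← ENNReal.div_eq_inv_mul, ENNReal.le_div_iff_mul_le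
    (Or.inl fun h => hpos.ne' (by simp [Measure.real, h])) (Or.inl (measure_ne_top _ _)),
    ← ENNReal.toReal_le_toReal (ENNReal.mul_ne_top (by finiteness) (measure_ne_top _ _))
      (measure_ne_top _ _), ENNReal.toReal_mul]
  simpa [Measure.real] using hreal
end
end

section
/- Let K > 0, let h : ℝ → ℝ_{≥0} be a K-log-Lipschitz function and g : ℝ → ℝ_{≥0} a convex function with ∫_{−∞}^{∞} g(x)h(x) dx = 1. If X ∈ ℝ is a random variable with probability density g·h, then for every ε > 0, Pr[X ∈ [−ε, ε]] ≤ 8εK. -/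
open MeasureTheory Set

noncomputable section

/-- A nonnegative integrable function bounded below by `c * e^{-K (y - a)}` on `(a, ∞)` has
integral at least `c / K`. -/
theorem le_mul_integral_of_exp_decay_le {K : ℝ} (hK : 0 < K) {f : ℝ → ℝ} {a c : ℝ}
    (hf : Integrable f) (hf0 : ∀ x, 0 ≤ f x)
    (hle : ∀ y, a < y → c * Real.exp (-K * (y - a)) ≤ f y) :
    c ≤ K * ∫ x, f x := by
  have hexp : ∀ y, c * Real.exp (-K * (y - a)) = c * Real.exp (K * a) * Real.exp (-K * y) := by
    intro y
    rw [mul_assoc, ← Real.exp_add]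
    ring_nf
  have hint : IntegrableOn (fun y => c * Real.exp (K * a) * Real.exp (-K * y)) (Ioi a) :=
    (integrableOn_exp_mul_Ioi (neg_neg_of_pos hK) a).const_mul _
  have hval : ∫ y in Ioi a, c * Real.exp (K * a) * Real.exp (-K * y) = c / K := by
    rw [integral_const_mul, integral_exp_mul_Ioi (neg_neg_of_pos hK), neg_div_neg_eq,
      mul_div_assoc', mul_assoc, ← Real.exp_add]
    simp
  have hmono : c / K ≤ ∫ x, f x := by
    rw [← hval]
    refine (setIntegral_mono_on hint hf.integrableOn measurableSet_Ioi fun y hy => ?_).trans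
      (setIntegral_le_integral hf (Filter.Eventually.of_forall hf0))
    rw [← hexp]
    exact hle y hy
  rwa [div_le_iff₀' hK] at hmono

/-- A convex function on `ℝ` stays above its value at a point on at least one side. -/
theorem ConvexOn.forall_le_right_or_forall_le_left {g : ℝ → ℝ} (hg : ConvexOn ℝ Set.univ g)
    (a : ℝ) : (∀ y, a < y → g a ≤ g y) ∨ (∀ y, y < a → g a ≤ g y) := by
  by_contra! hcon
  obtain ⟨⟨y, hay, hgy⟩, z, hza, hgz⟩ := hcon
  have hmax := hg.le_max_of_mem_Icc (mem_univ z) (mem_univ y) ⟨hza.le, hay.le⟩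
  exact absurd hmax (not_le.mpr (max_lt hgz hgy))

/-- The product of a convex and a `K`-log-Lipschitz function, if integrable, is bounded by `K`
times its integral. -/
theorem ConvexOn.mul_logLipschitz_le_mul_integral {K : ℝ} (hK : 0 < K) {g h : ℝ → ℝ}
    (hg0 : ∀ x, 0 ≤ g x) (hh0 : ∀ x, 0 ≤ h x) (hg : ConvexOn ℝ Set.univ g)
    (hh : ∀ x y, h x ≤ Real.exp (K * |x - y|) * h y)
    (hint : Integrable fun x => g x * h x) (a : ℝ) :
    g a * h a ≤ K * ∫ x, g x * h x := by
  have hlower : ∀ y, g a ≤ g y → g a * h a * Real.exp (-K * |a - y|) ≤ g y * h y := by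
    intro y hy
    have hdecay : h a * Real.exp (-K * |a - y|) ≤ h y := by
      rw [neg_mul, Real.exp_neg, ← div_eq_mul_inv, div_le_iff₀' (Real.exp_pos _)]
      exact hh a y
    rw [mul_assoc]
    exact mul_le_mul hy hdecay (mul_nonneg (hh0 a) (Real.exp_pos _).le) (hg0 y)
  have hf0 : ∀ x, 0 ≤ g x * h x := fun x => mul_nonneg (hg0 x) (hh0 x)
  rcases hg.forall_le_right_or_forall_le_left a with hright | hleft
  · refine le_mul_integral_of_exp_decay_le (a := a) hK hint hf0 fun y hy => ?_
    have hbound := hlower y (hright y hy)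
    rwa [abs_of_neg (sub_neg.mpr hy), neg_sub] at hbound
  · rw [← integral_neg_eq_self (fun x => g x * h x)]
    refine le_mul_integral_of_exp_decay_le (a := -a) hK hint.comp_neg (fun x => hf0 (-x))
      fun y hy => ?_
    have hya : -y < a := by linarith
    have hbound := hlower (-y) (hleft (-y) hya)
    rwa [abs_of_pos (sub_pos.mpr hya), show a - -y = y - -a by ring] at hbound

/-- anti-concentration for a convex-times-log-Lipschitz density.
If `h : ℝ → ℝ≥0` is `K`-log-Lipschitz (`h x ≤ e^{K |x-y|} h y`), `g : ℝ → ℝ≥0` is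
convex, and `g · h` is a probability density (`∫ g h = 1`), then a random variable `X`
with density `g · h` satisfies `Pr[X ∈ [-ε, ε]] ≤ 8 ε K` for every `ε > 0`. -/
theorem stmt_11 (K : ℝ) (hK : 0 < K) (g h : ℝ → ℝ)
    (hg0 : ∀ x, 0 ≤ g x) (hh0 : ∀ x, 0 ≤ h x)
    (hgconv : ConvexOn ℝ Set.univ g)
    (hhlip : ∀ x y, h x ≤ Real.exp (K * |x - y|) * h y)
    (hnorm : ∫ x, g x * h x = 1)
    (ε : ℝ) (hε : 0 < ε) :
    ∫ x in Set.Icc (-ε) ε, g x * h x ≤ 8 * ε * K := by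
  have hint : Integrable fun x => g x * h x :=
    Integrable.of_integral_ne_zero (by rw [hnorm]; exact one_ne_zero)
  have hbound : ∀ x, g x * h x ≤ K := fun x => by
    simpa [hnorm] using hgconv.mul_logLipschitz_le_mul_integral hK hg0 hh0 hhlip hint x
  calc ∫ x in Set.Icc (-ε) ε, g x * h x
      ≤ ∫ _ in Set.Icc (-ε) ε, K :=
        setIntegral_mono hint.integrableOn (by simp) hbound
    _ = 2 * (ε * K) := by
        rw [setIntegral_const, Real.volume_real_Icc_of_le (by linarith), smul_eq_mul]
        ring
    _ ≤ 8 * ε * K := by nlinarith [mul_pos hε hK]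
end
end

section
/- Let ā₁,…,ā_n ∈ ℝ^d be points with r·B₁^d ⊆ conv(ā₁,…,ā_n) for some r > 0. If 0 ≤ ε ≤ r/2 and points a₁,…,a_n ∈ ℝ^d satisfy ‖a_i − ā_i‖₁ ≤ ε for all i ∈ [n], then (1 − 2ε/r)·conv(ā₁,…,ā_n) ⊆ conv(a₁,…,a_n) ⊆ (1 + ε/r)·conv(ā₁,…,ā_n). -/
open Set
open scoped Pointwise

noncomputable section

/-- The `ℓ₁` norm on `ℝ^d`. -/
def l1norm {d : ℕ} (x : Euc d) : ℝ := ∑ i, |x i|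

theorem l1norm_neg {d : ℕ} (x : Euc d) : l1norm (-x) = l1norm x := by
  simp [l1norm]

theorem l1norm_smul {d : ℕ} (c : ℝ) (x : Euc d) : l1norm (c • x) = |c| * l1norm x := by
  simp [l1norm, abs_mul, Finset.mul_sum]

theorem eq_zero_of_l1norm_nonpos {d : ℕ} {x : Euc d} (hx : l1norm x ≤ 0) : x = 0 := by
  ext i
  have hi : |x i| ≤ l1norm x :=
    Finset.single_le_sum (f := fun j => |x j|) (fun j _ => abs_nonneg _) (Finset.mem_univ i)
  exact abs_nonpos_iff.mp (hi.trans hx)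

/-- If `K` contains the `ℓ₁` ball of radius `r`, then `(ε / r) • K` contains the one of
radius `ε`. -/
theorem mem_smul_of_l1norm_le {d : ℕ} {K : Set (Euc d)} {r ε : ℝ} (hr : 0 < r)
    (hK : {x : Euc d | l1norm x ≤ r} ⊆ K) (hε : 0 ≤ ε) {v : Euc d} (hv : l1norm v ≤ ε) :
    v ∈ (ε / r) • K := by
  rcases hε.eq_or_lt with rfl | hε
  · refine ⟨0, hK (by simp [l1norm, hr.le]), ?_⟩
    simp [eq_zero_of_l1norm_nonpos hv]
  · refine ⟨(r / ε) • v, hK ?_, ?_⟩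
    · rw [mem_ofPred_eq, l1norm_smul, abs_of_pos (by positivity)]
      calc r / ε * l1norm v ≤ r / ε * ε := by gcongr
        _ = r := by field_simp
    · have h : ε / r * (r / ε) = 1 := by field_simp
      simp [smul_smul, h]

/-- A linear functional is bounded on the convex hull of a set by any bound on the set. -/
theorem le_of_mem_convexHull {E : Type*} [AddCommGroup E] [Module ℝ E] (f : E →ₗ[ℝ] ℝ)
    {s : Set E} {M : ℝ} (hs : ∀ x ∈ s, f x ≤ M) {x : E} (hx : x ∈ convexHull ℝ s) : f x ≤ M :=
  convexHull_min (t := {y | f y ≤ M}) hs (convex_halfSpace_le f.isLinear M) hx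

/-- stability of the convex hull under `ℓ₁` perturbations.
If `r · B₁^d ⊆ conv(ā₁,…,ā_n)`, `0 ≤ ε ≤ r/2`, and `‖a_i - ā_i‖₁ ≤ ε` for all `i`, then
`(1 - 2ε/r) conv(ā₁,…,ā_n) ⊆ conv(a₁,…,a_n) ⊆ (1 + ε/r) conv(ā₁,…,ā_n)`. -/
theorem stmt_13 (d n : ℕ) (abar a : Fin n → Euc d) (r ε : ℝ) (hr : 0 < r)
    (hball : {x : Euc d | l1norm x ≤ r} ⊆ convexHull ℝ (Set.range abar))
    (hε0 : 0 ≤ ε) (hεr : ε ≤ r / 2)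
    (hpert : ∀ i, l1norm (a i - abar i) ≤ ε) :
    (1 - 2 * ε / r) • convexHull ℝ (Set.range abar) ⊆ convexHull ℝ (Set.range a) ∧
      convexHull ℝ (Set.range a) ⊆ (1 + ε / r) • convexHull ℝ (Set.range abar) := by
  have hmem {v : Euc d} (hv : l1norm v ≤ ε) := mem_smul_of_l1norm_le hr hball hε0 hv
  have ht : 0 ≤ ε / r := by positivity
  have ht2 : 0 ≤ 1 - 2 * ε / r := by
    rw [sub_nonneg, div_le_one hr]
    linarith
  constructor
  · rintro _ ⟨y, hy, rfl⟩
    by_contra hx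
    obtain ⟨f, u, hfu, hux⟩ := geometric_hahn_banach_closed_point (convex_convexHull ℝ (range a))
      ((finite_range a).isClosed_convexHull ℝ) hx
    have h0 : (0 : Euc d) ∈ convexHull ℝ (range abar) := hball (by simp [l1norm, hr.le])
    have : Nonempty (Fin n) := range_nonempty_iff_nonempty.mp (convexHull_nonempty_iff.mp ⟨0, h0⟩)
    obtain ⟨i, hi⟩ := Finite.exists_max fun j => f (abar j)
    have hmax {z : Euc d} (hz : z ∈ convexHull ℝ (range abar)) : f z ≤ f (abar i) :=
      le_of_mem_convexHull f.toLinearMap (forall_mem_range.mpr hi) hz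
    obtain ⟨z, hz, hzv⟩ := hmem (v := abar i - a i) (by
      rw [← neg_sub, l1norm_neg]
      exact hpert i)
    have hdiff : ε / r * f z = f (abar i) - f (a i) := by
      simpa using congrArg f hzv
    have hai : f (a i) < u := hfu _ (subset_convexHull ℝ _ (mem_range_self i))
    have hM : 0 ≤ f (abar i) := by simpa using hmax h0
    have hxy : u < (1 - 2 * ε / r) * f y := by simpa using hux
    have hy' := mul_le_mul_of_nonneg_left (hmax hy) ht2
    have hz' := mul_le_mul_of_nonneg_left (hmax hz) ht
    have htM := mul_nonneg ht hM
    rw [mul_div_assoc] at hxy hy'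
    linarith
  · refine convexHull_min ?_ ((convex_convexHull ℝ _).smul _)
    rintro _ ⟨i, rfl⟩
    rw [(convex_convexHull ℝ _).add_smul zero_le_one ht, one_smul]
    exact ⟨abar i, subset_convexHull ℝ _ (mem_range_self i), a i - abar i, hmem (hpert i), by simp⟩
end
end

section
/- Let 0 < α ≤ β and let T ⊂ ℝ² be a convex polygon with α·B₂² ⊆ T ⊆ β·B₂². Then T has at least (π/2)·√(α/(β − α)) edges. -/
open Set
open scoped Pointwise

noncomputable section

/-- Number of edges (one-dimensional exposed faces) of a set. -/
def edgeCount {d : ℕ} (S : Set (Euc d)) : ℕ :=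
  Set.ncard {F : Set (Euc d) | IsExposed ℝ S F ∧ Module.finrank ℝ (vectorSpan ℝ F) = 1}

/-- The unit vector of the plane at angle `φ`. -/
def angleVector (φ : ℝ) : Euc 2 := !₂[Real.cos φ, Real.sin φ]

lemma inner_angleVector (φ ψ : ℝ) :
    inner ℝ (angleVector φ) (angleVector ψ) = Real.cos (ψ - φ) := by
  simp [angleVector, PiLp.inner_apply, Fin.sum_univ_two, Real.cos_sub]

lemma norm_angleVector (φ : ℝ) : ‖angleVector φ‖ = 1 := by
  have h := real_inner_self_eq_norm_sq (angleVector φ)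
  rw [inner_angleVector, sub_self, Real.cos_zero] at h
  nlinarith [norm_nonneg (angleVector φ)]

lemma exists_eq_norm_smul_angleVector (x : Euc 2) : ∃ ψ : ℝ, x = ‖x‖ • angleVector ψ := by
  set z : ℂ := ⟨x 0, x 1⟩ with hz
  have hnorm : ‖x‖ = ‖z‖ := by
    rw [EuclideanSpace.norm_eq, Complex.norm_eq_sqrt_sq_add_sq]
    simp [Fin.sum_univ_two, hz]
  refine ⟨z.arg, ?_⟩
  ext i
  fin_cases i
  · simp [angleVector, hnorm, hz]
  · simp [angleVector, hnorm, hz]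

instance fact_two_pi_pos : Fact (0 < 2 * Real.pi) := ⟨Real.two_pi_pos⟩

/-- Angles whose difference has large cosine are close on the circle. -/
lemma dist_addCircle_le_of_cos_le {φ ψ θ : ℝ} (hθ : 0 ≤ θ) (hθπ : θ ≤ Real.pi)
    (h : Real.cos θ ≤ Real.cos (φ - ψ)) :
    dist (φ : AddCircle (2 * Real.pi)) (ψ : AddCircle (2 * Real.pi)) ≤ θ := by
  rw [dist_eq_norm, ← AddCircle.coe_sub]
  have hpi : ‖((φ - ψ : ℝ) : AddCircle (2 * Real.pi))‖ ≤ Real.pi := by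
    have := AddCircle.norm_le_half_period (2 * Real.pi) Real.two_pi_pos.ne'
      (x := ((φ - ψ : ℝ) : AddCircle (2 * Real.pi)))
    rw [abs_of_pos Real.two_pi_pos] at this
    linarith
  by_contra! hlt
  have hcos := Real.strictAntiOn_cos ⟨hθ, hθπ⟩ ⟨norm_nonneg _, hpi⟩ hlt
  rw [AddCircle.norm_eq, Real.cos_abs, Real.cos_sub_int_mul_two_pi] at hcos
  linarith

lemma arccos_div_le {α β : ℝ} (hα : 0 < α) (hαβ : α ≤ β) :
    Real.arccos (α / β) ≤ 2 * Real.sqrt ((β - α) / α) := by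
  have hβ : 0 < β := hα.trans_le hαβ
  set θ := Real.arccos (α / β) with hθ
  have hθ0 : 0 ≤ θ := Real.arccos_nonneg _
  have hθ1 : θ ≤ Real.pi / 2 := Real.arccos_le_pi_div_two.2 (by positivity)
  have hcos : Real.cos θ = α / β :=
    Real.cos_arccos (by linarith [div_pos hα hβ]) ((div_le_one hβ).2 hαβ)
  have hle := Real.cos_le_one_div_sqrt_sq_add_one (x := θ) (by linarith [Real.pi_pos])
    (by linarith [Real.pi_pos])
  have hsq : θ ^ 2 ≤ 8 := by nlinarith [Real.pi_lt_four]
  have hsqrt : 1 + θ ^ 2 / 4 ≤ Real.sqrt (θ ^ 2 + 1) :=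
    Real.le_sqrt_of_sq_le (by nlinarith [sq_nonneg θ])
  rw [hcos, div_le_div_iff₀ hβ (by positivity)] at hle
  have hmain : (θ / 2) ^ 2 ≤ (β - α) / α := by
    rw [le_div_iff₀ hα]
    nlinarith
  linarith [Real.le_sqrt_of_sq_le hmain]

/-- A polytope has only finitely many exposed faces. -/
lemma finite_setOf_isExposed {d : ℕ} (s : Finset (Euc d)) :
    {F : Set (Euc d) | IsExposed ℝ (convexHull ℝ (s : Set (Euc d))) F}.Finite := by
  have hcomp : IsCompact (convexHull ℝ (s : Set (Euc d))) := s.finite_toSet.isCompact_convexHull ℝ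
  refine Set.Finite.of_finite_image (f := fun F => F.extremePoints ℝ)
    (s.finite_toSet.finite_subsets.subset ?_) ?_
  · rintro _ ⟨F, hF, rfl⟩
    exact hF.isExtreme.extremePoints_subset_extremePoints.trans extremePoints_convexHull_subset
  · intro F hF G hG hFG
    rw [← closure_convexHull_extremePoints (hF.isCompact hcomp) (hF.convex (convex_convexHull ℝ _)),
      ← closure_convexHull_extremePoints (hG.isCompact hcomp) (hG.convex (convex_convexHull ℝ _))]
    exact congrArg (fun A => closure (convexHull ℝ A)) hFG

/-- A non-extreme point of a plane set on a supporting line lies in a one-dimensional face. -/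
lemma finrank_vectorSpan_toExposed {T : Set (Euc 2)} {l : StrongDual ℝ (Euc 2)} (hl : l ≠ 0)
    {p : Euc 2} (hp : p ∈ l.toExposed T) (hpe : p ∉ T.extremePoints ℝ) :
    Module.finrank ℝ (vectorSpan ℝ (l.toExposed T)) = 1 := by
  apply le_antisymm
  · have hle : vectorSpan ℝ (l.toExposed T) ≤ LinearMap.ker l.toLinearMap := by
      rw [vectorSpan, Submodule.span_le]
      rintro _ ⟨x, hx, y, hy, rfl⟩
      have := le_antisymm (hx.2 y hy.1) (hy.2 x hx.1)
      simp [this]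
    have hl' : l.toLinearMap ≠ 0 := fun h => hl (ContinuousLinearMap.coe_injective h)
    have hker := Module.Dual.finrank_ker_add_one_of_ne_zero (f := l.toLinearMap) hl'
    rw [finrank_euclideanSpace_fin] at hker
    have := Submodule.finrank_mono hle
    omega
  · rw [Nat.one_le_iff_ne_zero, Ne, Submodule.finrank_eq_zero, vectorSpan_eq_bot_iff_subsingleton]
    intro hsub
    have hexp : IsExposed ℝ T (l.toExposed T) := ContinuousLinearMap.toExposed.isExposed
    rw [hsub.eq_singleton_of_mem hp] at hexp
    exact hpe (isExtreme_singleton.1 hexp.isExtreme)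

/-- Every ray from an interior point `0` leaves a compact convex set through a point
with a supporting functional. -/
lemma exists_support_on_ray {T : Set (Euc 2)} (hT : IsCompact T) (hconv : Convex ℝ T)
    (h0 : (0 : Euc 2) ∈ interior T) {u : Euc 2} (hu : u ≠ 0) :
    ∃ t : ℝ, 0 ≤ t ∧ ∃ l : StrongDual ℝ (Euc 2), l ≠ 0 ∧ t • u ∈ l.toExposed T := by
  have hcont : Continuous fun t : ℝ => t • u := by fun_prop
  have hK : IsCompact ((fun t : ℝ => t • u) ⁻¹' T) :=
    (isClosedEmbedding_smul_left hu).isCompact_preimage hT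
  have hK0 : (0 : ℝ) ∈ (fun t : ℝ => t • u) ⁻¹' T := by
    simpa using interior_subset h0
  obtain ⟨t, htT, hmax⟩ := hK.exists_isGreatest ⟨0, hK0⟩
  have hnot : t • u ∉ interior T := by
    intro hint
    have hnhds : (fun t : ℝ => t • u) ⁻¹' interior T ∈ nhds t :=
      (isOpen_interior.preimage hcont).mem_nhds hint
    obtain ⟨ε, hε, hball⟩ := Metric.mem_nhds_iff.1 hnhds
    have hmem : t + ε / 2 ∈ Metric.ball t ε := by
      rw [Metric.mem_ball, Real.dist_eq, add_sub_cancel_left, abs_of_pos (by positivity)]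
      linarith
    have := hmax (interior_subset (hball hmem) : (t + ε / 2) • u ∈ T)
    linarith
  obtain ⟨l, hl⟩ := geometric_hahn_banach_open_point hconv.interior isOpen_interior hnot
  refine ⟨t, hmax hK0, l, ?_, htT, fun y hy => ?_⟩
  · rintro rfl
    simpa using hl 0 h0
  · have hy' : y ∈ closure (interior T) := by
      rw [hconv.closure_interior_eq_closure_of_nonempty_interior ⟨0, h0⟩]
      exact subset_closure hy
    exact closure_minimal (fun x hx => (hl x hx).le)
      (isClosed_le l.continuous continuous_const) hy'

/-- A supporting line of a set containing the disk of radius `α` has distance at least `α`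
from the origin. -/
lemma exists_le_inner_of_mem_toExposed {T : Set (Euc 2)} {α : ℝ} (hα : 0 < α)
    (hinner : {x : Euc 2 | ‖x‖ ≤ α} ⊆ T) {l : StrongDual ℝ (Euc 2)} (hl : l ≠ 0) :
    ∃ ψ : ℝ, ∀ p ∈ l.toExposed T, α ≤ inner ℝ (angleVector ψ) p := by
  set ν := (InnerProductSpace.toDual ℝ (Euc 2)).symm l with hν
  have hinnerν : ∀ x, l x = inner ℝ ν x := fun x => by
    rw [hν, InnerProductSpace.toDual_symm_apply]
  have hνpos : 0 < ‖ν‖ := by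
    rw [norm_pos_iff, hν]
    simpa using hl
  obtain ⟨ψ, hψ⟩ := exists_eq_norm_smul_angleVector ν
  refine ⟨ψ, fun p hp => ?_⟩
  have hmem : α • angleVector ψ ∈ T := hinner (by
    simp [norm_smul, norm_angleVector, abs_of_pos hα])
  have hle := hp.2 _ hmem
  rw [hinnerν, hinnerν, hψ, real_inner_smul_left, real_inner_smul_left, real_inner_smul_right,
    inner_angleVector, sub_self, Real.cos_zero, mul_one] at hle
  exact le_of_mul_le_mul_left hle hνpos

/-- Finitely many closed arcs of radius `θ` that cover the circle up to finitely many points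
have total length at least `2π`. -/
lemma pi_le_card_mul_of_cover {ι κ : Type*} (E : Finset ι) (N : Finset κ)
    (c : ι → AddCircle (2 * Real.pi)) (d : κ → AddCircle (2 * Real.pi)) {θ : ℝ} (hθ : 0 ≤ θ)
    (hcover : ∀ x, (∃ i ∈ E, dist x (c i) ≤ θ) ∨ ∃ j ∈ N, dist x (d j) ≤ 0) :
    Real.pi ≤ E.card * θ := by
  have hsub : (Set.univ : Set (AddCircle (2 * Real.pi))) ⊆
      (⋃ i ∈ E, Metric.closedBall (c i) θ) ∪ ⋃ j ∈ N, Metric.closedBall (d j) 0 := by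
    intro x _
    simpa [Metric.mem_closedBall] using hcover x
  have hE : MeasureTheory.volume (⋃ i ∈ E, Metric.closedBall (c i) θ) ≤
      ENNReal.ofReal (E.card * (2 * θ)) := by
    refine (MeasureTheory.measure_biUnion_finset_le _ _).trans ?_
    simp only [AddCircle.volume_closedBall, Finset.sum_const, nsmul_eq_mul]
    rw [ENNReal.ofReal_mul (by positivity), ENNReal.ofReal_natCast]
    gcongr
    exact min_le_right _ _
  have hN : MeasureTheory.volume (⋃ j ∈ N, Metric.closedBall (d j) 0) ≤ 0 := by
    refine (MeasureTheory.measure_biUnion_finset_le _ _).trans ?_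
    simp only [AddCircle.volume_closedBall, mul_zero, min_eq_right Real.two_pi_pos.le,
      ENNReal.ofReal_zero, Finset.sum_const_zero, le_refl]
  have h := (MeasureTheory.measure_mono (μ := MeasureTheory.volume) hsub).trans
    ((MeasureTheory.measure_union_le _ _).trans (add_le_add hE hN))
  rw [AddCircle.measure_univ, add_zero, ENNReal.ofReal_le_ofReal_iff (by positivity)] at h
  linarith

/-- sandwiched polygons have many edges.
If a convex polygon `T ⊆ ℝ²` satisfies `α·B₂² ⊆ T ⊆ β·B₂²` with `0 < α ≤ β`, then `T`
has at least `(π/2)·√(α/(β-α))` edges. -/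
theorem stmt_14 (α β : ℝ) (hα : 0 < α) (hαβ : α ≤ β)
    (T : Set (Euc 2)) (hpoly : ∃ s : Finset (Euc 2), T = convexHull ℝ (↑s : Set (Euc 2)))
    (hinner : {x : Euc 2 | ‖x‖ ≤ α} ⊆ T)
    (houter : T ⊆ {x : Euc 2 | ‖x‖ ≤ β}) :
    Real.pi / 2 * Real.sqrt (α / (β - α)) ≤ (edgeCount T : ℝ) := by
  obtain ⟨s, hs⟩ := hpoly
  have hβ : 0 < β := hα.trans_le hαβ
  have hconv : Convex ℝ T := hs ▸ convex_convexHull ℝ _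
  have hcomp : IsCompact T := hs ▸ s.finite_toSet.isCompact_convexHull ℝ
  have h0 : (0 : Euc 2) ∈ interior T := by
    refine mem_interior_iff_mem_nhds.2 (Filter.mem_of_superset (Metric.closedBall_mem_nhds 0 hα) ?_)
    intro x hx
    exact hinner (by simpa using hx)
  have hfin : {F : Set (Euc 2) | IsExposed ℝ T F ∧
      Module.finrank ℝ (vectorSpan ℝ F) = 1}.Finite :=
    (hs ▸ finite_setOf_isExposed s : {F | IsExposed ℝ T F}.Finite).subset fun F hF => hF.1
  have hnormal : ∀ F : Set (Euc 2), ∃ ψ : ℝ, (∃ ψ' : ℝ, ∀ p ∈ F, α ≤ inner ℝ (angleVector ψ') p) →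
      ∀ p ∈ F, α ≤ inner ℝ (angleVector ψ) p := by
    intro F
    by_cases h : ∃ ψ' : ℝ, ∀ p ∈ F, α ≤ inner ℝ (angleVector ψ') p
    · exact h.imp fun ψ hψ _ => hψ
    · exact ⟨0, fun h' => absurd h' h⟩
  choose c hc using hnormal
  choose d hd using exists_eq_norm_smul_angleVector
  have hcard := pi_le_card_mul_of_cover hfin.toFinset s (fun F => (c F : AddCircle (2 * Real.pi)))
    (fun x => (d x : AddCircle (2 * Real.pi))) (Real.arccos_nonneg (α / β)) (by
      intro x
      obtain ⟨φ, rfl⟩ := QuotientAddGroup.mk_surjective x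
      have hu : angleVector φ ≠ 0 := fun h => by simpa [h] using norm_angleVector φ
      obtain ⟨t, ht, l, hl, hmem⟩ := exists_support_on_ray hcomp hconv h0 hu
      have hle := hc _ (exists_le_inner_of_mem_toExposed hα hinner hl) _ hmem
      rw [real_inner_smul_right, inner_angleVector] at hle
      have htpos : 0 < t := ht.lt_of_ne fun h => by simp [← h] at hle; linarith
      by_cases hts : t • angleVector φ ∈ s
      · right
        refine ⟨_, hts, dist_addCircle_le_of_cos_le le_rfl Real.pi_pos.le ?_⟩
        have h := hd (t • angleVector φ)
        rw [norm_smul, norm_angleVector, mul_one, Real.norm_of_nonneg ht] at h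
        have heq := smul_right_injective _ htpos.ne' h
        rw [← inner_angleVector, ← heq, inner_angleVector, sub_self]
      · left
        refine ⟨l.toExposed T, hfin.mem_toFinset.2
          ⟨ContinuousLinearMap.toExposed.isExposed, finrank_vectorSpan_toExposed hl hmem ?_⟩,
          dist_addCircle_le_of_cos_le (Real.arccos_nonneg _) (Real.arccos_le_pi _) ?_⟩
        · rw [hs]
          exact fun h => hts (extremePoints_convexHull_subset h)
        · have htβ : t ≤ β := by
            simpa [norm_smul, norm_angleVector, abs_of_pos htpos] using houter hmem.1
          rw [Real.cos_arccos (by linarith [div_pos hα hβ]) ((div_le_one hβ).2 hαβ), div_le_iff₀ hβ]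
          have : 0 ≤ Real.cos (φ - c (l.toExposed T)) := by
            by_contra! hneg
            nlinarith
          nlinarith)
  rw [← Set.ncard_eq_toFinset_card _ hfin] at hcard
  change Real.pi ≤ (edgeCount T : ℝ) * _ at hcard
  rcases hαβ.eq_or_lt with rfl | hlt
  · simp
  have hr : 0 < (β - α) / α := div_pos (sub_pos.2 hlt) hα
  have hfinal := hcard.trans
    (mul_le_mul_of_nonneg_left (arccos_div_le hα hαβ) (Nat.cast_nonneg _))
  rw [← inv_div (β - α) α, Real.sqrt_inv, ← div_eq_mul_inv, div_le_iff₀ (Real.sqrt_pos.2 hr)]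
  linarith
end
end
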